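/- arXiv:1906.06924 — 4 statements merged into one kernel-verified Lean document; each statement's English description precedes it below -/
import Mathlib

section
/- Let M ≥ 1, D ≥ 0 and L ≥ 1 be integers, and let p_d ∈ ℝ^L be given for each d in the simplex lattice ℕ_D^M. Then the uniform average over the standard (M−1)-simplex of the function t ↦ ‖∑_{d ∈ ℕ_D^M} C(D; d) t^d p_d‖² (Euclidean norm on ℝ^L, t^d := ∏_{i=1}^M t_i^{d_i}) equals ∑_{d_A, d_B ∈ ℕ_D^M} Σ_{d_A d_B} ⟨p_{d_A}, p_{d_B}⟩, where ⟨·,·⟩ is the Euclidean inner product on ℝ^L. -/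
open MeasureTheory Finset
open scoped RealInnerProductSpace

/-- Fintype instance for the simplex lattice `ℕ_D^M`. -/
instance latticeFintype (M D : ℕ) : Fintype {d : Fin M → ℕ // ∑ i, d i = D} :=
  Fintype.subtype (Finset.Nat.antidiagonalTuple M D)
    (fun _ => Finset.Nat.mem_antidiagonalTuple)

/-- Uniform average over the standard `m`-simplex (`M = m + 1` vertices) of a
function `f : ℝ^{m+1} → ℝ`, realized as `m! ∫_T f(t, 1 - ∑ t) dt`. -/
noncomputable def simplexAvg (m : ℕ) (f : (Fin (m+1) → ℝ) → ℝ) : ℝ :=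
  (Nat.factorial m : ℝ) *
    ∫ t in {t : Fin m → ℝ | (∀ i, 0 ≤ t i) ∧ ∑ i, t i ≤ 1},
      f (Fin.snoc t (1 - ∑ i, t i))

/-- The matrix entry `Σ_{d_A d_B}` (here `M = m+1`, so `(M-1)! = m!` and
`(2D+M-1)! = (2D+m)!`). -/
noncomputable def sigmaEntry (m D : ℕ) (dA dB : Fin (m+1) → ℕ) : ℝ :=
  ((Nat.factorial (2*D) : ℝ) * (Nat.factorial m) / (Nat.factorial (2*D + m))) *
    (Nat.multinomial Finset.univ dA) * (Nat.multinomial Finset.univ dB) /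
    (Nat.multinomial Finset.univ (dA + dB))

lemma oneDim (s : ℝ) (a n : ℕ) :
    ∫ x in (0:ℝ)..s, x ^ a * (s - x) ^ n =
      (a.factorial : ℝ) * n.factorial / (a + n + 1).factorial * s ^ (a + n + 1) := by
  induction a generalizing n with
  | zero =>
    have h : ∫ x in (0:ℝ)..s, (s - x) ^ n = ∫ x in (0:ℝ)..s, x ^ n := by
      have := intervalIntegral.integral_comp_sub_left (a := 0) (b := s) (fun x : ℝ => x ^ n) s
      simpa using this
    simp only [pow_zero, one_mul, h, integral_pow, zero_add, Nat.factorial_zero, Nat.cast_one]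
    rw [Nat.factorial_succ]
    have := Nat.factorial_ne_zero n
    push_cast
    field_simp
    simp
  | succ a ih =>
    have hd : ∀ x ∈ Set.uIcc (0:ℝ) s, HasDerivAt (fun x : ℝ => x ^ (a+1) * (s - x) ^ (n+1))
        (((a:ℝ)+1) * (x ^ a * (s - x) ^ (n+1)) - ((n:ℝ)+1) * (x ^ (a+1) * (s - x) ^ n)) x := by
      intro x _
      have h1 := hasDerivAt_pow (a+1) x
      have h2 := ((hasDerivAt_id x).const_sub s).pow (n+1)
      refine (h1.mul h2).congr_deriv ?_
      simp only [Pi.pow_apply, id, Nat.add_sub_cancel]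
      push_cast
      ring
    have hint := intervalIntegral.integral_eq_sub_of_hasDerivAt hd
      (Continuous.intervalIntegrable (by fun_prop) _ _)
    rw [intervalIntegral.integral_sub (Continuous.intervalIntegrable (by fun_prop) _ _)
      (Continuous.intervalIntegrable (by fun_prop) _ _),
      intervalIntegral.integral_const_mul, intervalIntegral.integral_const_mul, ih] at hint
    simp only [sub_self, ne_eq, Nat.succ_ne_zero, not_false_eq_true, zero_pow, mul_zero,
      zero_mul] at hint
    have hn : ((n:ℝ)+1) ≠ 0 := by positivity
    apply mul_left_cancel₀ hn
    rw [← sub_eq_zero.mp hint, show a + 1 + n + 1 = a + (n + 1) + 1 by ring,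
      Nat.factorial_succ a, Nat.factorial_succ n]
    push_cast
    ring

/-- The solid simplex of size `s`. -/
def solidT (m : ℕ) (s : ℝ) : Set (Fin m → ℝ) := {t | (∀ i, 0 ≤ t i) ∧ ∑ i, t i ≤ s}

lemma solidT_compact (m : ℕ) (s : ℝ) : IsCompact (solidT m s) := by
  apply (isCompact_Icc (a := (0 : Fin m → ℝ)) (b := fun _ => s)).of_isClosed_subset
  · have h : solidT m s = (⋂ i, {t : Fin m → ℝ | 0 ≤ t i}) ∩ {t | ∑ i, t i ≤ s} := by
      ext t; simp [solidT]
    rw [h]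
    refine (isClosed_iInter fun i => isClosed_le (by fun_prop) (by fun_prop)).inter
      (isClosed_le (by fun_prop) (by fun_prop))
  · intro t ht
    refine ⟨fun i => ht.1 i, fun i => ?_⟩
    exact (Finset.single_le_sum (f := t) (fun j _ => ht.1 j) (Finset.mem_univ i)).trans ht.2

lemma solidT_integral (m : ℕ) (a : Fin m → ℕ) (b : ℕ) (s : ℝ) (hs : 0 ≤ s) :
    ∫ t in solidT m s, (∏ i, t i ^ a i) * (s - ∑ i, t i) ^ b =
      (∏ i, ((a i).factorial : ℝ)) * b.factorial / (∑ i, a i + b + m).factorial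
        * s ^ (∑ i, a i + b + m) := by
  induction m generalizing s with
  | zero =>
    have h : solidT 0 s = Set.univ := by ext t; simp [solidT, hs]
    have hb := Nat.factorial_ne_zero b
    rw [h, Measure.restrict_univ]
    simp [integral_unique, Measure.real, volume_pi, hb]
  | succ m ih =>
    have hm := (solidT_compact (m+1) s).measurableSet
    rw [← integral_indicator hm,
      ← (volume_preserving_piFinSuccAbove (fun _ : Fin (m+1) => ℝ) 0).symm.integral_comp'
        ((solidT (m+1) s).indicator _)]
    have hI : Integrable ((solidT (m+1) s).indicator
        (fun t : Fin (m+1) → ℝ => (∏ i, t i ^ a i) * (s - ∑ i, t i) ^ b)) := by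
      rw [integrable_indicator_iff hm]
      exact ContinuousOn.integrableOn_compact (solidT_compact _ _)
        (Continuous.continuousOn (by fun_prop))
    have hI2 := ((volume_preserving_piFinSuccAbove (fun _ : Fin (m+1) => ℝ) 0).symm
      ).integrable_comp_of_integrable hI
    rw [Measure.volume_eq_prod] at hI2 ⊢
    refine (integral_prod _ hI2).trans ?_
    simp only [Function.comp_apply]
    set N := ∑ i : Fin m, a i.succ + b + m with hN
    have key : ∀ x : ℝ, (∫ y : Fin m → ℝ, (solidT (m+1) s).indicator
        (fun t : Fin (m+1) → ℝ => (∏ i, t i ^ a i) * (s - ∑ i, t i) ^ b)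
        ((MeasurableEquiv.piFinSuccAbove (fun _ : Fin (m+1) => ℝ) 0).symm (x, y)))
        = (Set.Icc 0 s).indicator (fun x => ((∏ i : Fin m, ((a i.succ).factorial : ℝ))
          * b.factorial / N.factorial) * (x ^ a 0 * (s - x) ^ N)) x := by
      intro x
      have hmem : ∀ y : Fin m → ℝ, (MeasurableEquiv.piFinSuccAbove
          (fun _ : Fin (m+1) => ℝ) 0).symm (x, y) = Fin.cons x y := by
        intro y; simp [MeasurableEquiv.piFinSuccAbove, Fin.insertNthEquiv]
      simp only [hmem]
      by_cases hx : x ∈ Set.Icc 0 s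
      · rw [Set.indicator_of_mem hx]
        have := ih (fun i => a i.succ) (s - x) (sub_nonneg.mpr hx.2)
        rw [← integral_indicator (solidT_compact m _).measurableSet] at this
        rw [mul_comm (x ^ a 0), ← mul_assoc, ← this, mul_comm, ← integral_const_mul]
        congr 1
        ext y
        have hiff : Fin.cons x y ∈ solidT (m+1) s ↔ y ∈ solidT m (s - x) := by
          simp only [solidT, Set.mem_setOf_eq, Fin.forall_fin_succ, Fin.cons_zero, Fin.cons_succ,
            Fin.sum_univ_succ, hx.1, true_and, le_sub_iff_add_le']
        by_cases hy : y ∈ solidT m (s - x)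
        · rw [Set.indicator_of_mem (hiff.mpr hy), Set.indicator_of_mem hy]
          simp only [Fin.prod_univ_succ, Fin.sum_univ_succ, Fin.cons_zero, Fin.cons_succ]
          rw [sub_sub, mul_assoc]
        · rw [Set.indicator_of_notMem (fun h => hy (hiff.mp h)), Set.indicator_of_notMem hy,
            mul_zero]
      · rw [Set.indicator_of_notMem hx]
        rw [← integral_zero (Fin m → ℝ) ℝ (μ := volume)]
        congr 1
        ext y
        apply Set.indicator_of_notMem
        rintro ⟨h1, h2⟩
        rw [Fin.sum_univ_succ] at h2
        simp only [Fin.forall_fin_succ, Fin.cons_zero, Fin.cons_succ] at h1 h2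
        exact hx ⟨h1.1, by
          have := Finset.sum_nonneg (s := Finset.univ) (f := y) fun i _ => h1.2 i
          linarith⟩
    simp only [key]
    rw [integral_indicator measurableSet_Icc, integral_const_mul, integral_Icc_eq_integral_Ioc,
      ← intervalIntegral.integral_of_le hs, oneDim]
    rw [Fin.prod_univ_succ, Fin.sum_univ_succ,
      show a 0 + ∑ i : Fin m, a i.succ + b + (m + 1) = a 0 + N + 1 by rw [hN]; ring]
    have := Nat.factorial_ne_zero N
    field_simp

lemma simplexAvg_monomial (m D : ℕ) (dA dB : Fin (m+1) → ℕ) (hA : ∑ i, dA i = D)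
    (hB : ∑ i, dB i = D) (c : ℝ) :
    (m.factorial : ℝ) * ∫ t in solidT m 1, ((Nat.multinomial Finset.univ dA : ℝ) *
        (∏ i, (Fin.snoc t (1 - ∑ i, t i) : Fin (m+1) → ℝ) i ^ dA i)) *
        ((Nat.multinomial Finset.univ dB : ℝ) *
        (∏ i, (Fin.snoc t (1 - ∑ i, t i) : Fin (m+1) → ℝ) i ^ dB i)) * c
      = sigmaEntry m D dA dB * c := by
  have h := solidT_integral m (fun i => (dA + dB) i.castSucc) ((dA + dB) (Fin.last m)) 1 zero_le_one
  have hsum : ∑ i, (dA + dB) i = 2 * D := by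
    simp only [Pi.add_apply, Finset.sum_add_distrib, hA, hB]; ring
  have hspec := Nat.multinomial_spec Finset.univ (dA + dB)
  rw [← Fin.sum_univ_castSucc, ← Fin.prod_univ_castSucc (fun i => (((dA + dB) i).factorial : ℝ)),
    hsum, one_pow, mul_one] at h
  rw [hsum] at hspec
  have hspec' : (∏ i, (((dA + dB) i).factorial : ℝ)) * (Nat.multinomial Finset.univ (dA + dB) : ℝ)
      = (2 * D).factorial := by exact_mod_cast hspec
  have hne : (Nat.multinomial Finset.univ (dA + dB) : ℝ) ≠ 0 := by
    intro h0
    rw [h0, mul_zero] at hspec'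
    exact Nat.factorial_ne_zero (2 * D) (by exact_mod_cast hspec'.symm)
  rw [integral_mul_const]
  have hcongr : ∀ t : Fin m → ℝ, ((Nat.multinomial Finset.univ dA : ℝ) *
        (∏ i, (Fin.snoc t (1 - ∑ i, t i) : Fin (m+1) → ℝ) i ^ dA i)) *
        ((Nat.multinomial Finset.univ dB : ℝ) *
        (∏ i, (Fin.snoc t (1 - ∑ i, t i) : Fin (m+1) → ℝ) i ^ dB i)) =
      ((Nat.multinomial Finset.univ dA : ℝ) * (Nat.multinomial Finset.univ dB : ℝ)) *
        ((∏ i, t i ^ (dA + dB) i.castSucc) * (1 - ∑ i, t i) ^ (dA + dB) (Fin.last m)) := by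
    intro t
    simp only [Fin.prod_univ_castSucc, Fin.snoc_castSucc, Fin.snoc_last, Pi.add_apply, pow_add,
      Finset.prod_mul_distrib]
    ring
  simp only [hcongr]
  rw [integral_const_mul, h, sigmaEntry, ← hspec']
  field_simp

/-- the uniform average over the simplex of
`t ↦ ‖∑_d C(D;d) t^d p_d‖²` equals `∑_{d_A,d_B} Σ_{d_A d_B} ⟨p_{d_A}, p_{d_B}⟩`. -/
theorem simplexAvg_norm_sq_bezier (m D L : ℕ) (hL : 1 ≤ L)
    (p : {d : Fin (m+1) → ℕ // ∑ i, d i = D} → EuclideanSpace ℝ (Fin L)) :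
    simplexAvg m (fun t =>
      ‖∑ d : {d : Fin (m+1) → ℕ // ∑ i, d i = D},
          ((Nat.multinomial Finset.univ d.1 : ℝ) * ∏ i, t i ^ d.1 i) • p d‖ ^ 2)
    = ∑ dA : {d : Fin (m+1) → ℕ // ∑ i, d i = D},
        ∑ dB : {d : Fin (m+1) → ℕ // ∑ i, d i = D},
          sigmaEntry m D dA.1 dB.1 * ⟪p dA, p dB⟫ := by
  have hint : ∀ dA dB : {d : Fin (m+1) → ℕ // ∑ i, d i = D},
      Integrable (fun t : Fin m → ℝ => ((Nat.multinomial Finset.univ dA.1 : ℝ) *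
        (∏ i, (Fin.snoc t (1 - ∑ i, t i) : Fin (m+1) → ℝ) i ^ dA.1 i)) *
        ((Nat.multinomial Finset.univ dB.1 : ℝ) *
        (∏ i, (Fin.snoc t (1 - ∑ i, t i) : Fin (m+1) → ℝ) i ^ dB.1 i)) * ⟪p dA, p dB⟫)
        (volume.restrict (solidT m 1)) := by
    intro dA dB
    refine ContinuousOn.integrableOn_compact (solidT_compact _ _)
        (Continuous.continuousOn ?_)
    simp only [Fin.prod_univ_castSucc, Fin.snoc_castSucc, Fin.snoc_last]
    fun_prop
  have hmono := fun dA dB : {d : Fin (m+1) → ℕ // ∑ i, d i = D} =>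
    (simplexAvg_monomial m D dA.1 dB.1 dA.2 dB.2 ⟪p dA, p dB⟫).symm
  simp only [hmono]
  unfold simplexAvg
  change _ * ∫ t in solidT m 1, _ = _
  simp only [← Finset.mul_sum]
  congr 1
  have hs : ∀ dA : {d : Fin (m+1) → ℕ // ∑ i, d i = D}, _ :=
    fun dA => integral_finset_sum Finset.univ (fun dB _ => hint dA dB)
  simp only [← hs]
  rw [← integral_finset_sum _ (fun dA _ => integrable_finset_sum _ (fun dB _ => hint dA dB))]
  congr 1
  ext t
  rw [← real_inner_self_eq_norm_sq, sum_inner]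
  refine Finset.sum_congr rfl fun dA _ => ?_
  rw [inner_sum]
  refine Finset.sum_congr rfl fun dB _ => ?_
  rw [real_inner_smul_left, real_inner_smul_right, ← mul_assoc]
end

section
/- For all integers M ≥ 1 and D ≥ 0, the matrix Σ with rows and columns indexed by the simplex lattice ℕ_D^M and entries Σ_{d_A d_B} = ((2D)!(M−1)!/(2D+M−1)!) · C(D; d_A) · C(D; d_B) · C(2D; d_A+d_B)^{−1} is non-singular (its determinant is nonzero). -/
open Finset

lemma aux_choose (D a b : ℕ) (hb : b ≤ D) :
    (a + b).choose b = ∑ k ∈ Finset.range (D+1), a.choose k * b.choose k := by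
  rw [Nat.add_choose_eq, Finset.Nat.sum_antidiagonal_eq_sum_range_succ
    (fun i j => a.choose i * b.choose j)]
  have h1 : ∀ k ∈ Finset.range b.succ, a.choose k * b.choose (b - k)
      = a.choose k * b.choose k := by
    intro k hk
    rw [Nat.choose_symm (by simpa [Nat.lt_succ_iff] using hk)]
  rw [Finset.sum_congr rfl h1]
  apply Finset.sum_subset
  · intro k hk
    simp only [Finset.mem_range] at *
    omega
  · intro k _ hk
    simp only [Finset.mem_range] at hk
    rw [Nat.choose_eq_zero_of_lt (show b < k by omega), mul_zero]

lemma aux_prod (M D : ℕ) (a b : Fin M → ℕ) (hb : ∑ i, b i = D) :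
    (∏ i, ((a i + b i).choose (b i) : ℝ)) =
      ∑ k ∈ Fintype.piFinset (fun _ : Fin M => Finset.range (D+1)),
        (∏ i, ((a i).choose (k i) : ℝ)) * (∏ i, ((b i).choose (k i) : ℝ)) := by
  have h : ∀ i, ((a i + b i).choose (b i) : ℝ) =
      ∑ k ∈ Finset.range (D+1), ((a i).choose k : ℝ) * ((b i).choose k : ℝ) := by
    intro i
    have hi : b i ≤ D := by
      rw [← hb]
      exact Finset.single_le_sum (f := b) (fun _ _ => Nat.zero_le _) (Finset.mem_univ i)
    rw [aux_choose D (a i) (b i) hi]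
    push_cast
    rfl
  simp_rw [h]
  rw [Finset.prod_univ_sum]
  simp_rw [Finset.prod_mul_distrib]

lemma aux_mult (M D : ℕ) (a : Fin M → ℕ) (ha : ∑ i, a i = D) :
    (Nat.multinomial Finset.univ a : ℝ) = (Nat.factorial D : ℝ) / ∏ i, ((a i).factorial : ℝ) := by
  have hp : (∏ i, ((a i).factorial : ℝ)) ≠ 0 :=
    Finset.prod_ne_zero_iff.mpr fun i _ => by exact_mod_cast (a i).factorial_ne_zero
  rw [eq_div_iff hp, mul_comm]
  have := Nat.multinomial_spec Finset.univ a
  rw [ha] at this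
  exact_mod_cast this

lemma aux_entry (m D : ℕ) : ∃ c : ℝ, c ≠ 0 ∧ ∀ a b : Fin (m+1) → ℕ, ∑ i, a i = D →
    ∑ i, b i = D → sigmaEntry m D a b = c * ∏ i, ((a i + b i).choose (b i) : ℝ) := by
  have hf : ∀ n : ℕ, (n.factorial : ℝ) ≠ 0 := fun n => by exact_mod_cast n.factorial_ne_zero
  refine ⟨((Nat.factorial (2*D) : ℝ) * (Nat.factorial m) / (Nat.factorial (2*D + m))) *
    (D.factorial : ℝ) * D.factorial / (2*D).factorial, ?_, ?_⟩
  · have h1 := hf (2*D)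
    have h2 := hf m
    have h3 := hf (2*D+m)
    have h4 := hf D
    positivity
  · intro a b ha hb
    have hp : ∀ a : Fin (m+1) → ℕ, (∏ i, ((a i).factorial : ℝ)) ≠ 0 := fun a =>
      Finset.prod_ne_zero_iff.mpr fun i _ => hf _
    have hc : (∏ i, ((a i + b i).choose (b i) : ℝ)) =
        (∏ i, (((a + b) i).factorial : ℝ)) /
          ((∏ i, ((a i).factorial : ℝ)) * ∏ i, ((b i).factorial : ℝ)) := by
      rw [eq_div_iff (mul_ne_zero (hp a) (hp b)), ← Finset.prod_mul_distrib,
        ← Finset.prod_mul_distrib]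
      refine Finset.prod_congr rfl fun i _ => ?_
      have := Nat.add_choose_mul_factorial_mul_factorial (b i) (a i)
      rw [Pi.add_apply]
      have h2 : (a i + b i).choose (b i) * ((a i).factorial * (b i).factorial)
          = (a i + b i).factorial := by
        have := Nat.choose_mul_factorial_mul_factorial (Nat.le_add_left (b i) (a i))
        rw [Nat.add_sub_cancel] at this
        rw [← this]; ring
      exact_mod_cast h2
    have hab : ∑ i, (a + b) i = 2 * D := by
      simp only [Pi.add_apply, Finset.sum_add_distrib, ha, hb]; ring
    rw [sigmaEntry, aux_mult _ D a ha, aux_mult _ D b hb, aux_mult _ (2*D) (a+b) hab, hc]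
    have h1 := hp a
    have h2 := hp b
    have h3 := hp (a+b)
    have h4 := hf (2*D)
    have h5 := hf (2*D+m)
    field_simp

/-- the matrix `Σ` indexed by the simplex lattice is non-singular. -/
theorem sigmaMatrix_det_ne_zero (m D : ℕ) :
    (Matrix.of (fun dA dB : {d : Fin (m+1) → ℕ // ∑ i, d i = D} =>
      sigmaEntry m D dA.1 dB.1)).det ≠ 0 := by
  intro hdet
  obtain ⟨v, hv, hMv⟩ := Matrix.exists_mulVec_eq_zero_iff.mpr hdet
  obtain ⟨c, hc, hent⟩ := aux_entry m D
  apply hv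
  have h1 : ∀ a : {d : Fin (m+1) → ℕ // ∑ i, d i = D},
      ∑ b : {d : Fin (m+1) → ℕ // ∑ i, d i = D},
        (∏ i, ((a.1 i + b.1 i).choose (b.1 i) : ℝ)) * v b = 0 := by
    intro a
    have h := congrFun hMv a
    simp only [Matrix.mulVec, dotProduct, Matrix.of_apply, Pi.zero_apply] at h
    simp_rw [fun b : {d : Fin (m+1) → ℕ // ∑ i, d i = D} => hent a.1 b.1 a.2 b.2,
      mul_assoc] at h
    rw [← Finset.mul_sum] at h
    exact (mul_eq_zero.mp h).resolve_left hc
  have h2 : ∑ k ∈ Fintype.piFinset (fun _ : Fin (m+1) => Finset.range (D+1)),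
      (∑ a : {d : Fin (m+1) → ℕ // ∑ i, d i = D},
        v a * ∏ i, ((a.1 i).choose (k i) : ℝ)) ^ 2 = 0 := by
    have h3 : ∑ a : {d : Fin (m+1) → ℕ // ∑ i, d i = D}, v a *
      ∑ b : {d : Fin (m+1) → ℕ // ∑ i, d i = D},
        (∏ i, ((a.1 i + b.1 i).choose (b.1 i) : ℝ)) * v b = 0 :=
      Finset.sum_eq_zero fun a _ => by rw [h1 a, mul_zero]
    rw [← h3]
    simp_rw [fun a b : {d : Fin (m+1) → ℕ // ∑ i, d i = D} => aux_prod (m+1) D a.1 b.1 b.2,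
      sq, Finset.sum_mul_sum, Finset.sum_mul, Finset.mul_sum]
    rw [Finset.sum_comm]
    refine Finset.sum_congr rfl fun a _ => ?_
    rw [Finset.sum_comm]
    refine Finset.sum_congr rfl fun b _ => ?_
    refine Finset.sum_congr rfl fun k _ => ?_
    ring
  rw [Finset.sum_eq_zero_iff_of_nonneg (fun _ _ => sq_nonneg _)] at h2
  funext k
  have hk := h2 k.1 (by
    rw [Fintype.mem_piFinset]
    intro i
    have : k.1 i ≤ ∑ j, k.1 j :=
      Finset.single_le_sum (f := k.1) (fun _ _ => Nat.zero_le _) (Finset.mem_univ i)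
    rw [k.2] at this
    simpa [Nat.lt_succ_iff] using this)
  have hk' := pow_eq_zero_iff (two_ne_zero) |>.mp hk
  rw [Finset.sum_eq_single k] at hk'
  · simpa using hk'
  · intro a _ hak
    have : ∃ i, a.1 i < k.1 i := by
      by_contra! hcon
      apply hak
      apply Subtype.ext
      funext i
      have := (Finset.sum_eq_sum_iff_of_le (fun i (_ : i ∈ Finset.univ) => hcon i)).mp
        (k.2.trans a.2.symm)
      exact (this i (Finset.mem_univ i)).symm
    obtain ⟨i, hi⟩ := this
    rw [Finset.prod_eq_zero (Finset.mem_univ i), mul_zero]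
    rw [Nat.choose_eq_zero_of_lt hi, Nat.cast_zero]
  · intro h
    exact absurd (Finset.mem_univ k) h
end

section
/- For all integers M ≥ 1 and D ≥ 0, the matrix Σ with rows and columns indexed by the simplex lattice ℕ_D^M and entries Σ_{d_A d_B} = ((2D)!(M−1)!/(2D+M−1)!) · C(D; d_A) · C(D; d_B) · C(2D; d_A+d_B)^{−1} is symmetric positive definite: Σ_{d_A d_B} = Σ_{d_B d_A} for all d_A, d_B, and for every nonzero real vector v indexed by ℕ_D^M one has ∑_{d_A, d_B} v_{d_A} Σ_{d_A d_B} v_{d_B} > 0. -/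
open Finset

lemma vandermonde_aux (a b N : ℕ) (h : a ≤ N) :
    ((a + b).choose a : ℝ) = ∑ k ∈ Finset.range (N + 1), (a.choose k : ℝ) * (b.choose k : ℝ) := by
  have h1 : (a + b).choose a = ∑ k ∈ Finset.range (a + 1), a.choose k * b.choose k := by
    rw [add_comm a b, Nat.add_choose_eq, Finset.Nat.sum_antidiagonal_eq_sum_range_succ_mk]
    apply Finset.sum_congr rfl
    intro k hk
    have hk' : k ≤ a := by simpa [Nat.lt_succ_iff] using hk
    simp only [Nat.choose_symm hk']
    ring
  rw [h1]
  push_cast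
  apply Finset.sum_subset
  · intro k hk
    simp only [Finset.mem_range] at *
    omega
  · intro k _ hk
    simp only [Finset.mem_range] at hk
    rw [Nat.choose_eq_zero_of_lt (by omega)]
    simp

lemma sigmaEntry_eq (m D : ℕ) (a b : Fin (m+1) → ℕ) (ha : ∑ i, a i = D) (hb : ∑ i, b i = D) :
    sigmaEntry m D a b =
      ((Nat.factorial m : ℝ) * (Nat.factorial D) ^ 2 / (Nat.factorial (2*D + m))) *
      ∑ k ∈ Fintype.piFinset (fun _ : Fin (m+1) => Finset.range (D + 1)),
        (∏ i, ((a i).choose (k i) : ℝ)) * (∏ i, ((b i).choose (k i) : ℝ)) := by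
  have hv : ∑ k ∈ Fintype.piFinset (fun _ : Fin (m+1) => Finset.range (D + 1)),
        (∏ i, ((a i).choose (k i) : ℝ)) * (∏ i, ((b i).choose (k i) : ℝ))
      = ∏ i, ((a i + b i).choose (a i) : ℝ) := by
    simp_rw [← Finset.prod_mul_distrib]
    rw [← Finset.prod_univ_sum (fun _ : Fin (m+1) => Finset.range (D + 1))
      (fun i k => ((a i).choose k : ℝ) * ((b i).choose k : ℝ))]
    apply Finset.prod_congr rfl
    intro i _
    rw [vandermonde_aux (a i) (b i) D]
    rw [← ha]
    exact Finset.single_le_sum (f := a) (fun _ _ => Nat.zero_le _) (Finset.mem_univ i)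
  rw [hv]
  have h1 : (∏ i, ((a i).factorial : ℝ)) * (Nat.multinomial Finset.univ a : ℝ) = D.factorial := by
    have := Nat.multinomial_spec Finset.univ a
    rw [ha] at this
    exact_mod_cast this
  have h2 : (∏ i, ((b i).factorial : ℝ)) * (Nat.multinomial Finset.univ b : ℝ) = D.factorial := by
    have := Nat.multinomial_spec Finset.univ b
    rw [hb] at this
    exact_mod_cast this
  have h3 : (∏ i, ((a i + b i).factorial : ℝ)) * (Nat.multinomial Finset.univ (a + b) : ℝ)
      = (2 * D).factorial := by
    have := Nat.multinomial_spec Finset.univ (a + b)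
    simp only [Pi.add_apply, Finset.sum_add_distrib, ha, hb, ← two_mul] at this
    exact_mod_cast this
  have h4 : (∏ i, ((a i + b i).factorial : ℝ)) = (∏ i, ((a i + b i).choose (a i) : ℝ)) *
      (∏ i, ((a i).factorial : ℝ)) * (∏ i, ((b i).factorial : ℝ)) := by
    rw [← Finset.prod_mul_distrib, ← Finset.prod_mul_distrib]
    apply Finset.prod_congr rfl
    intro i _
    have := Nat.add_choose_mul_factorial_mul_factorial (a i) (b i)
    rw [← Nat.choose_symm_add] at this
    exact_mod_cast this.symm
  have p3 : (Nat.multinomial Finset.univ (a + b) : ℝ) ≠ 0 := by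
    intro h
    rw [h, mul_zero] at h3
    exact (Nat.cast_ne_zero.mpr (Nat.factorial_ne_zero _)) h3.symm
  have p4 : ((2 * D + m).factorial : ℝ) ≠ 0 := Nat.cast_ne_zero.mpr (Nat.factorial_ne_zero _)
  unfold sigmaEntry
  rw [← h3, h4, sq]
  nth_rewrite 1 [← h1]
  rw [← h2]
  field_simp

/-- the matrix `Σ` is symmetric positive definite. -/
theorem sigmaMatrix_symm_posDef (m D : ℕ) :
    (∀ dA dB : {d : Fin (m+1) → ℕ // ∑ i, d i = D},
      sigmaEntry m D dA.1 dB.1 = sigmaEntry m D dB.1 dA.1) ∧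
    (∀ v : {d : Fin (m+1) → ℕ // ∑ i, d i = D} → ℝ, v ≠ 0 →
      0 < ∑ dA : {d : Fin (m+1) → ℕ // ∑ i, d i = D},
            ∑ dB : {d : Fin (m+1) → ℕ // ∑ i, d i = D},
              v dA * sigmaEntry m D dA.1 dB.1 * v dB) := by
  refine ⟨?_, ?_⟩
  · intro a b
    unfold sigmaEntry
    rw [add_comm a.1 b.1]
    ring
  · intro v hv
    obtain ⟨a, ha⟩ := Function.ne_iff.mp hv
    have key : ∑ dA : {d : Fin (m+1) → ℕ // ∑ i, d i = D},
            ∑ dB : {d : Fin (m+1) → ℕ // ∑ i, d i = D},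
              v dA * sigmaEntry m D dA.1 dB.1 * v dB =
        ((Nat.factorial m : ℝ) * (Nat.factorial D) ^ 2 / (Nat.factorial (2*D + m))) *
        ∑ k ∈ Fintype.piFinset (fun _ : Fin (m+1) => Finset.range (D + 1)),
          (∑ d : {d : Fin (m+1) → ℕ // ∑ i, d i = D},
            v d * ∏ i, ((d.1 i).choose (k i) : ℝ)) ^ 2 := by
      simp_rw [sq, Finset.sum_mul_sum]
      rw [Finset.sum_comm, Finset.mul_sum]
      simp_rw [Finset.mul_sum]
      rw [Finset.sum_comm' (t' := Finset.univ)
        (s' := fun _ => Fintype.piFinset (fun _ : Fin (m+1) => Finset.range (D + 1)))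
        (by simp)]
      rw [Finset.sum_comm]
      apply Finset.sum_congr rfl
      intro x _
      rw [Finset.sum_comm]
      apply Finset.sum_congr rfl
      intro y _
      rw [sigmaEntry_eq m D _ _ x.2 y.2, Finset.mul_sum, Finset.mul_sum, Finset.sum_mul]
      apply Finset.sum_congr rfl
      intro k _
      ring
    rw [key]
    apply mul_pos
    · have := Nat.factorial_pos m
      have := Nat.factorial_pos D
      have := Nat.factorial_pos (2 * D + m)
      positivity
    · apply Finset.sum_pos'
      · intro k _
        positivity
      · refine ⟨a.1, ?_, ?_⟩
        · simp only [Fintype.mem_piFinset, Finset.mem_range]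
          intro i
          have h := Finset.single_le_sum (f := a.1) (fun _ _ => Nat.zero_le _) (Finset.mem_univ i)
          rw [a.2] at h
          omega
        · rw [Finset.sum_eq_single a]
          · simp only [Nat.choose_self, Nat.cast_one, Finset.prod_const_one, mul_one]
            exact sq_pos_of_ne_zero ha
          · intro b _ hba
            have : ∃ i, b.1 i < a.1 i := by
              by_contra hcon
              push Not at hcon
              apply hba
              apply Subtype.ext
              funext i
              have h := (Finset.sum_eq_sum_iff_of_le (fun i _ => hcon i)).mp (a.2.trans b.2.symm)
              exact (h i (Finset.mem_univ i)).symm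
            obtain ⟨i, hi⟩ := this
            rw [Finset.prod_eq_zero (Finset.mem_univ i), mul_zero]
            rw [Nat.choose_eq_zero_of_lt hi]
            simp
          · simp
end

section
/- Let M ≥ 1 and D ≥ 0 be integers and let P be a nonzero polynomial in M variables over ℝ that is homogeneous of degree D. Then the uniform average over the standard (M−1)-simplex of the function t ↦ (P(t))² is strictly positive. -/
open MeasureTheory Finset

theorem homog_eval_smul {n D : ℕ} (P : MvPolynomial (Fin n) ℝ) (hP : P.IsHomogeneous D)
    (c : ℝ) (x : Fin n → ℝ) :
    MvPolynomial.eval (fun i => c * x i) P = c ^ D * MvPolynomial.eval x P := by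
  rw [MvPolynomial.eval_eq, MvPolynomial.eval_eq, Finset.mul_sum]
  refine Finset.sum_congr rfl fun d hd => ?_
  have h := hP (MvPolynomial.mem_support_iff.1 hd)
  rw [Finsupp.weight_apply, Finsupp.sum] at h
  simp only [Pi.one_apply, smul_eq_mul, mul_one] at h
  simp only [mul_pow]
  rw [Finset.prod_mul_distrib, Finset.prod_pow_eq_pow_sum]
  have : ∑ i ∈ d.support, d i = D := h
  rw [this]
  ring

/-- for a nonzero homogeneous polynomial `P`, the uniform average
over the standard simplex of `P²` is strictly positive. -/
theorem simplexAvg_sq_pos_of_homogeneous_ne_zero (m D : ℕ)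
    (P : MvPolynomial (Fin (m+1)) ℝ) (hP : P.IsHomogeneous D) (hne : P ≠ 0) :
    0 < simplexAvg m (fun t => (MvPolynomial.eval t P) ^ 2) := by
  obtain ⟨x, hx, hxe⟩ : ∃ x : Fin (m+1) → ℝ, (∀ i, 0 < x i) ∧ MvPolynomial.eval x P ≠ 0 := by
    by_contra! hcon
    apply hne
    refine MvPolynomial.funext_set (fun _ => Set.Ioi (0:ℝ)) (fun _ => Set.Ioi_infinite 0) ?_
    intro x hx
    rw [hcon x (fun i => hx i (Set.mem_univ i)), map_zero]
  have hs : 0 < ∑ i, x i := Finset.sum_pos (fun i _ => hx i) Finset.univ_nonempty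
  set s := ∑ i, x i with hsdef
  let y : Fin (m+1) → ℝ := fun i => s⁻¹ * x i
  have hy : ∀ i, 0 < y i := fun i => mul_pos (inv_pos.2 hs) (hx i)
  have hye : MvPolynomial.eval y P ≠ 0 := by
    rw [homog_eval_smul P hP]
    exact mul_ne_zero (pow_ne_zero _ (inv_pos.2 hs).ne') hxe
  have hysum : ∑ i, y i = 1 := by
    rw [← Finset.mul_sum]
    exact inv_mul_cancel₀ hs.ne'
  rw [Fin.sum_univ_castSucc] at hysum
  let g : (Fin m → ℝ) → ℝ := fun t =>
    (MvPolynomial.eval (Fin.snoc t (1 - ∑ i, t i) : Fin (m+1) → ℝ) P) ^ 2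
  have hg : Continuous g := by
    refine ((MvPolynomial.continuous_eval P).comp ?_).pow 2
    refine continuous_pi fun i => ?_
    refine Fin.lastCases ?_ (fun j => ?_) i
    · simp only [Fin.snoc_last]
      fun_prop
    · simp only [Fin.snoc_castSucc]
      fun_prop
  let T : Set (Fin m → ℝ) := {t | (∀ i, 0 ≤ t i) ∧ ∑ i, t i ≤ 1}
  have hTc : IsClosed T := by
    refine IsClosed.inter (s₁ := {t : Fin m → ℝ | ∀ i, 0 ≤ t i})
      (s₂ := {t : Fin m → ℝ | ∑ i, t i ≤ 1}) ?_ ?_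
    · simp only [Set.ofPred_forall]
      exact isClosed_iInter fun i => isClosed_le continuous_const (continuous_apply i)
    · exact isClosed_le (by fun_prop) continuous_const
  have hTk : IsCompact T := by
    refine (isCompact_Icc (a := (0 : Fin m → ℝ)) (b := 1)).of_isClosed_subset hTc ?_
    rintro t ⟨h0, h1⟩
    exact ⟨h0, fun i => (Finset.single_le_sum (fun j _ => h0 j) (Finset.mem_univ i)).trans h1⟩
  have hint : IntegrableOn g T := hg.continuousOn.integrableOn_compact hTk
  have key : 0 < ∫ t in T, g t := by
    rw [setIntegral_pos_iff_support_of_nonneg_ae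
      (Filter.Eventually.of_forall fun t => sq_nonneg _) hint]
    let U : Set (Fin m → ℝ) := {t | (∀ i, 0 < t i)} ∩ ({t | ∑ i, t i < 1} ∩ {t | g t ≠ 0})
    have hU : IsOpen U := by
      refine IsOpen.inter ?_ (IsOpen.inter ?_ ?_)
      · simp only [Set.ofPred_forall]
        exact isOpen_iInter_of_finite fun i => isOpen_lt continuous_const (continuous_apply i)
      · exact isOpen_lt (by fun_prop) continuous_const
      · exact isOpen_ne_fun hg continuous_const
    have hUn : U.Nonempty := by
      refine ⟨fun i => y i.castSucc, fun i => hy _, ?_, ?_⟩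
      · have := hy (Fin.last m)
        simp only [Set.mem_setOf_eq]
        linarith
      · have he : (Fin.snoc (fun i : Fin m => y i.castSucc) (1 - ∑ i : Fin m, y i.castSucc) :
            Fin (m+1) → ℝ) = y := by
          funext i
          refine Fin.lastCases ?_ (fun j => ?_) i
          · simp only [Fin.snoc_last]
            linarith
          · simp only [Fin.snoc_castSucc]
        change (MvPolynomial.eval _ P) ^ 2 ≠ 0
        rw [he]
        exact pow_ne_zero _ hye
    refine (hU.measure_pos volume hUn).trans_le (measure_mono ?_)
    rintro t ⟨h0, h1, h2⟩
    exact ⟨h2, fun i => (h0 i).le, le_of_lt h1⟩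
  exact mul_pos (by exact_mod_cast Nat.factorial_pos m) key
end
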